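/- The continuous extension h_CE : ℝⁿ → ℝ, defined by h_CE(x) := h̄_PB(x) if h_PB(x) = 0 and h_CE(x) := h_PB(x) otherwise, is continuous on ℝⁿ. Moreover, h_CE(x) ≤ 0 for every x with h_PB(x) = 0 and h_CE(x) = h_PB(x) > 0 for every x with h_PB(x) > 0. -/

import Mathlib

/-- Closed-loop trajectory: `traj f x u 0 = x`, `traj f x u (i+1) = f (traj f x u i, u i)`. -/
noncomputable def traj {n m : ℕ}
    (f : EuclideanSpace ℝ (Fin n) × EuclideanSpace ℝ (Fin m) → EuclideanSpace ℝ (Fin n))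
    (x : EuclideanSpace ℝ (Fin n)) (u : ℕ → EuclideanSpace ℝ (Fin m)) :
    ℕ → EuclideanSpace ℝ (Fin n)
  | 0 => x
  | i + 1 => f (traj f x u i, u i)

/-- Soft-constrained PCBF cost of an input sequence `u`:
`α_f · max 0 (h_f x_N) + Σ_{i<N} ‖max 0 (c x_i + Δ_i 𝟙)‖` (componentwise max,
Euclidean norm). -/
noncomputable def pcbfCost {n m nc : ℕ} (N : ℕ)
    (f : EuclideanSpace ℝ (Fin n) × EuclideanSpace ℝ (Fin m) → EuclideanSpace ℝ (Fin n))
    (c : EuclideanSpace ℝ (Fin n) → EuclideanSpace ℝ (Fin nc)) (Δ : ℕ → ℝ)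
    (hf : EuclideanSpace ℝ (Fin n) → ℝ) (αf : ℝ)
    (x : EuclideanSpace ℝ (Fin n)) (u : ℕ → EuclideanSpace ℝ (Fin m)) : ℝ :=
  αf * max 0 (hf (traj f x u N)) +
    ∑ i ∈ Finset.range N,
      ‖((fun j => max 0 (c (traj f x u i) j + Δ i)) : Fin nc → ℝ)‖

/-- The PCBF `h_PB x`: infimum of `pcbfCost` over admissible input sequences. -/
noncomputable def hPB {n m nc : ℕ} (N : ℕ) (U : Set (EuclideanSpace ℝ (Fin m)))
    (f : EuclideanSpace ℝ (Fin n) × EuclideanSpace ℝ (Fin m) → EuclideanSpace ℝ (Fin n))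
    (c : EuclideanSpace ℝ (Fin n) → EuclideanSpace ℝ (Fin nc)) (Δ : ℕ → ℝ)
    (hf : EuclideanSpace ℝ (Fin n) → ℝ) (αf : ℝ) (x : EuclideanSpace ℝ (Fin n)) : ℝ :=
  sInf ((fun u => pcbfCost N f c Δ hf αf x u) '' {u | ∀ i < N, u i ∈ U})

/-- Cost of the extended value function: `max { max_{i<N, j} ([c x_i]_j + Δ_i), h_f x_N }`. -/
noncomputable def extCost {n m nc : ℕ} (N : ℕ)
    (f : EuclideanSpace ℝ (Fin n) × EuclideanSpace ℝ (Fin m) → EuclideanSpace ℝ (Fin n))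
    (c : EuclideanSpace ℝ (Fin n) → EuclideanSpace ℝ (Fin nc)) (Δ : ℕ → ℝ)
    (hf : EuclideanSpace ℝ (Fin n) → ℝ)
    (x : EuclideanSpace ℝ (Fin n)) (u : ℕ → EuclideanSpace ℝ (Fin m)) : ℝ :=
  max (⨆ q : Fin N × Fin nc, (c (traj f x u q.1) q.2 + Δ q.1)) (hf (traj f x u N))

/-- The extended value function `h̄_PB x` (slacks not sign-constrained). -/
noncomputable def hbarPB {n m nc : ℕ} (N : ℕ) (U : Set (EuclideanSpace ℝ (Fin m)))
    (f : EuclideanSpace ℝ (Fin n) × EuclideanSpace ℝ (Fin m) → EuclideanSpace ℝ (Fin n))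
    (c : EuclideanSpace ℝ (Fin n) → EuclideanSpace ℝ (Fin nc)) (Δ : ℕ → ℝ)
    (hf : EuclideanSpace ℝ (Fin n) → ℝ) (x : EuclideanSpace ℝ (Fin n)) : ℝ :=
  sInf ((fun u => extCost N f c Δ hf x u) '' {u | ∀ i < N, u i ∈ U})

theorem continuous_traj {n m : ℕ}
    {f : EuclideanSpace ℝ (Fin n) × EuclideanSpace ℝ (Fin m) → EuclideanSpace ℝ (Fin n)}
    (hfc : Continuous f) (i : ℕ) :
    Continuous (fun p : EuclideanSpace ℝ (Fin n) × (ℕ → EuclideanSpace ℝ (Fin m)) =>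
      traj f p.1 p.2 i) := by
  induction i with
  | zero => exact continuous_fst
  | succ i ih =>
    exact hfc.comp (ih.prodMk ((continuous_apply i).comp continuous_snd))

theorem traj_congr {n m : ℕ}
    (f : EuclideanSpace ℝ (Fin n) × EuclideanSpace ℝ (Fin m) → EuclideanSpace ℝ (Fin n))
    (x : EuclideanSpace ℝ (Fin n)) {u v : ℕ → EuclideanSpace ℝ (Fin m)} {i : ℕ}
    (h : ∀ k < i, u k = v k) : traj f x u i = traj f x v i := by
  induction i with
  | zero => rfl
  | succ i ih =>
    simp only [traj]
    rw [ih fun k hk => h k (by omega), h i (by omega)]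

theorem continuous_pcbfCost {n m nc : ℕ} (N : ℕ)
    {f : EuclideanSpace ℝ (Fin n) × EuclideanSpace ℝ (Fin m) → EuclideanSpace ℝ (Fin n)}
    (hfc : Continuous f)
    {c : EuclideanSpace ℝ (Fin n) → EuclideanSpace ℝ (Fin nc)} (hcc : Continuous c)
    (Δ : ℕ → ℝ) {hf : EuclideanSpace ℝ (Fin n) → ℝ} (hfcont : Continuous hf) (αf : ℝ) :
    Continuous (fun p : EuclideanSpace ℝ (Fin n) × (ℕ → EuclideanSpace ℝ (Fin m)) =>
      pcbfCost N f c Δ hf αf p.1 p.2) := by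
  have ht := continuous_traj hfc
  unfold pcbfCost
  refine (continuous_const.mul (continuous_const.max (hfcont.comp (ht N)))).add
    (continuous_finsetSum _ fun i _ => Continuous.norm (continuous_pi fun j => ?_))
  have := hcc.comp (ht i)
  fun_prop

theorem continuous_extCost {n m nc N : ℕ} (hN : 0 < N) (hnc : 0 < nc)
    {f : EuclideanSpace ℝ (Fin n) × EuclideanSpace ℝ (Fin m) → EuclideanSpace ℝ (Fin n)}
    (hfc : Continuous f)
    {c : EuclideanSpace ℝ (Fin n) → EuclideanSpace ℝ (Fin nc)} (hcc : Continuous c)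
    (Δ : ℕ → ℝ) {hf : EuclideanSpace ℝ (Fin n) → ℝ} (hfcont : Continuous hf) :
    Continuous (fun p : EuclideanSpace ℝ (Fin n) × (ℕ → EuclideanSpace ℝ (Fin m)) =>
      extCost N f c Δ hf p.1 p.2) := by
  have ht := continuous_traj hfc
  have : Nonempty (Fin N × Fin nc) := ⟨(⟨0, hN⟩, ⟨0, hnc⟩)⟩
  unfold extCost
  simp only [← Finset.sup'_univ_eq_ciSup]
  refine Continuous.max (Continuous.finset_sup'_apply _ fun q _ => ?_) (hfcont.comp (ht N))
  have := hcc.comp (ht q.1)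
  fun_prop

theorem pcbfCost_nonneg {n m nc : ℕ} (N : ℕ)
    (f : EuclideanSpace ℝ (Fin n) × EuclideanSpace ℝ (Fin m) → EuclideanSpace ℝ (Fin n))
    (c : EuclideanSpace ℝ (Fin n) → EuclideanSpace ℝ (Fin nc)) (Δ : ℕ → ℝ)
    (hf : EuclideanSpace ℝ (Fin n) → ℝ) {αf : ℝ} (hαf : 0 < αf)
    (x : EuclideanSpace ℝ (Fin n)) (u : ℕ → EuclideanSpace ℝ (Fin m)) :
    0 ≤ pcbfCost N f c Δ hf αf x u := by
  unfold pcbfCost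
  positivity

/-- Both costs detect feasibility: the soft-constrained cost vanishes exactly when the
extended cost is non-positive. -/
theorem pcbfCost_eq_zero_iff {n m nc N : ℕ} (hN : 0 < N) (hnc : 0 < nc)
    (f : EuclideanSpace ℝ (Fin n) × EuclideanSpace ℝ (Fin m) → EuclideanSpace ℝ (Fin n))
    (c : EuclideanSpace ℝ (Fin n) → EuclideanSpace ℝ (Fin nc)) (Δ : ℕ → ℝ)
    (hf : EuclideanSpace ℝ (Fin n) → ℝ) {αf : ℝ} (hαf : 0 < αf)
    (x : EuclideanSpace ℝ (Fin n)) (u : ℕ → EuclideanSpace ℝ (Fin m)) :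
    pcbfCost N f c Δ hf αf x u = 0 ↔ extCost N f c Δ hf x u ≤ 0 := by
  have : Nonempty (Fin N × Fin nc) := ⟨(⟨0, hN⟩, ⟨0, hnc⟩)⟩
  unfold pcbfCost extCost
  rw [add_eq_zero_iff_of_nonneg (by positivity) (by positivity),
    Finset.sum_eq_zero_iff_of_nonneg (fun _ _ => norm_nonneg _), max_le_iff,
    ciSup_le_iff (Set.finite_range _).bddAbove, and_comm]
  refine and_congr ?_ (by simp [hαf.ne'])
  simp only [norm_eq_zero, funext_iff, Pi.zero_apply, max_eq_left_iff, Finset.mem_range]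
  exact ⟨fun h q => h q.1 q.1.2 q.2, fun h i hi j => h (⟨i, hi⟩, j)⟩

/-- A cost depending only on the first `N` inputs has the same values over sequences whose first
`N` inputs lie in `U` as over sequences with all inputs in `U`. -/
theorem image_admissible_eq {E α : Type*} {N : ℕ} {U : Set E} (hUne : U.Nonempty)
    {J : (ℕ → E) → α} (hJ : ∀ u v : ℕ → E, (∀ k < N, u k = v k) → J u = J v) :
    J '' {u | ∀ i < N, u i ∈ U} = J '' Set.univ.pi fun _ => U := by
  obtain ⟨w, hw⟩ := hUne
  refine Set.Subset.antisymm ?_ (Set.image_mono fun u hu i _ => hu i trivial)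
  rintro _ ⟨u, hu, rfl⟩
  refine ⟨fun i => if i < N then u i else w, fun i _ => ?_, hJ _ _ fun k hk => if_pos hk⟩
  by_cases hi : i < N
  · simpa [hi] using hu i hi
  · simpa [hi] using hw

theorem hPB_eq_sInf_pi {n m nc N : ℕ} {U : Set (EuclideanSpace ℝ (Fin m))} (hUne : U.Nonempty)
    (f : EuclideanSpace ℝ (Fin n) × EuclideanSpace ℝ (Fin m) → EuclideanSpace ℝ (Fin n))
    (c : EuclideanSpace ℝ (Fin n) → EuclideanSpace ℝ (Fin nc)) (Δ : ℕ → ℝ)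
    (hf : EuclideanSpace ℝ (Fin n) → ℝ) (αf : ℝ) (x : EuclideanSpace ℝ (Fin n)) :
    hPB N U f c Δ hf αf x = sInf (pcbfCost N f c Δ hf αf x '' Set.univ.pi fun _ => U) := by
  unfold hPB
  rw [image_admissible_eq hUne]
  intro u v h
  unfold pcbfCost
  rw [traj_congr f x h]
  congr 1
  refine Finset.sum_congr rfl fun i hi => ?_
  rw [traj_congr f x fun k hk => h k (hk.trans (Finset.mem_range.1 hi))]

theorem hbarPB_eq_sInf_pi {n m nc N : ℕ} {U : Set (EuclideanSpace ℝ (Fin m))}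
    (hUne : U.Nonempty)
    (f : EuclideanSpace ℝ (Fin n) × EuclideanSpace ℝ (Fin m) → EuclideanSpace ℝ (Fin n))
    (c : EuclideanSpace ℝ (Fin n) → EuclideanSpace ℝ (Fin nc)) (Δ : ℕ → ℝ)
    (hf : EuclideanSpace ℝ (Fin n) → ℝ) (x : EuclideanSpace ℝ (Fin n)) :
    hbarPB N U f c Δ hf x = sInf (extCost N f c Δ hf x '' Set.univ.pi fun _ => U) := by
  unfold hbarPB
  rw [image_admissible_eq hUne]
  intro u v h
  unfold extCost
  rw [traj_congr f x h]
  congr 1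
  refine iSup_congr fun q => ?_
  rw [traj_congr f x fun k hk => h k (hk.trans q.1.2)]

open Classical in
/-- The continuous extension `h_CE` (equal to `h̄_PB` on `{h_PB = 0}` and to `h_PB`
elsewhere) is continuous, non-positive on `{h_PB = 0}`, and coincides with `h_PB`
(and is positive) where `h_PB > 0`. -/
theorem stmt14
    {n m nc N : ℕ} (hN : 0 < N) (hnc : 0 < nc)
    (U : Set (EuclideanSpace ℝ (Fin m))) (hUcomp : IsCompact U) (hUne : U.Nonempty)
    (f : EuclideanSpace ℝ (Fin n) × EuclideanSpace ℝ (Fin m) → EuclideanSpace ℝ (Fin n))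
    (hfc : Continuous f)
    (c : EuclideanSpace ℝ (Fin n) → EuclideanSpace ℝ (Fin nc)) (hcc : Continuous c)
    (Δ : ℕ → ℝ)
    (hf : EuclideanSpace ℝ (Fin n) → ℝ) (hfcont : Continuous hf)
    (αf : ℝ) (hαf : 0 < αf) :
    Continuous (fun x => if hPB N U f c Δ hf αf x = 0
        then hbarPB N U f c Δ hf x else hPB N U f c Δ hf αf x) ∧
    (∀ x : EuclideanSpace ℝ (Fin n), hPB N U f c Δ hf αf x = 0 →
      (if hPB N U f c Δ hf αf x = 0
        then hbarPB N U f c Δ hf x else hPB N U f c Δ hf αf x) ≤ 0) ∧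
    (∀ x : EuclideanSpace ℝ (Fin n), 0 < hPB N U f c Δ hf αf x →
      (if hPB N U f c Δ hf αf x = 0
        then hbarPB N U f c Δ hf x else hPB N U f c Δ hf αf x) = hPB N U f c Δ hf αf x ∧
      0 < (if hPB N U f c Δ hf αf x = 0
        then hbarPB N U f c Δ hf x else hPB N U f c Δ hf αf x)) := by
  have hK : IsCompact (Set.univ.pi fun _ : ℕ => U) := isCompact_univ_pi fun _ => hUcomp
  have hKne : (Set.univ.pi fun _ : ℕ => U).Nonempty := Set.univ_pi_nonempty_iff.2 fun _ => hUne
  have hJ := continuous_pcbfCost N hfc hcc Δ hfcont αf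
  have hL := continuous_extCost hN hnc hfc hcc Δ hfcont
  have hPBcont : Continuous (hPB N U f c Δ hf αf) := by
    rw [funext (hPB_eq_sInf_pi hUne f c Δ hf αf)]
    exact hK.continuous_sInf hJ
  have hbarcont : Continuous (hbarPB N U f c Δ hf) := by
    rw [funext (hbarPB_eq_sInf_pi hUne f c Δ hf)]
    exact hK.continuous_sInf hL
  have hnonneg : ∀ x, 0 ≤ hPB N U f c Δ hf αf x := by
    intro x
    refine Real.sInf_nonneg ?_
    rintro _ ⟨u, -, rfl⟩
    exact pcbfCost_nonneg N f c Δ hf hαf x u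
  have hiff : ∀ x, hPB N U f c Δ hf αf x = 0 ↔ hbarPB N U f c Δ hf x ≤ 0 := by
    intro x
    have hJx : Continuous (pcbfCost N f c Δ hf αf x) := hJ.comp (Continuous.prodMk_right x)
    have hLx : Continuous (extCost N f c Δ hf x) := hL.comp (Continuous.prodMk_right x)
    rw [hPB_eq_sInf_pi hUne, hbarPB_eq_sInf_pi hUne]
    constructor
    · intro h
      obtain ⟨u, hu, hu'⟩ := hK.exists_sInf_image_eq hKne hJx.continuousOn
      refine (csInf_le (hK.image hLx).bddBelow ⟨u, hu, rfl⟩).trans ?_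
      exact (pcbfCost_eq_zero_iff hN hnc f c Δ hf hαf x u).1 (hu'.symm.trans h)
    · intro h
      obtain ⟨u, hu, hu'⟩ := hK.exists_sInf_image_eq hKne hLx.continuousOn
      have h0 := (pcbfCost_eq_zero_iff hN hnc f c Δ hf hαf x u).2 (hu'.symm.trans_le h)
      refine le_antisymm ((csInf_le (hK.image hJx).bddBelow ⟨u, hu, rfl⟩).trans h0.le) ?_
      rw [← hPB_eq_sInf_pi hUne]
      exact hnonneg x
  refine ⟨?_, fun x hx => ?_, fun x hx => ?_⟩
  · refine ((hbarcont.min continuous_const).add hPBcont).congr (f := fun x =>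
      min (hbarPB N U f c Δ hf x) 0 + hPB N U f c Δ hf αf x) fun x => ?_
    split_ifs with h
    · rw [h, add_zero, min_eq_left ((hiff x).1 h)]
    · rw [min_eq_right (le_of_not_ge fun h' => h ((hiff x).2 h')), zero_add]
  · rw [if_pos hx]
    exact (hiff x).1 hx
  · rw [if_neg hx.ne']
    exact ⟨rfl, hx⟩
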